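/- arXiv:1602.06052 — 2 statements merged into one kernel-verified Lean document; each statement's English description precedes it below -/
import Mathlib

section
/- Let ψ and φ be CNF formulas that contain no tautological clauses, and let X be a subset of the variables of ψ and φ. If ψ ⊨ φ, then for every Y ∈ tA(X) it holds that ψ[Y] ⊨ φ[Y]. -/
/-- Propositional variables. -/
abbrev Var := ℕ
/-- A literal is a variable together with a polarity (`true` = positive). -/
abbrev Lit := Var × Bool
/-- A clause is a finite set of literals (their disjunction). -/
abbrev Clause := Finset Lit
/-- A CNF formula is a finite set of clauses (their conjunction). -/
abbrev CNF := Finset Clause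

/-- The complement `∼ℓ` of a literal. -/
def litCompl (l : Lit) : Lit := (l.1, !l.2)

/-- An assignment satisfies a clause if some literal of it is true. -/
def satClause (θ : Var → Bool) (C : Clause) : Prop := ∃ l ∈ C, θ l.1 = l.2

/-- An assignment satisfies a CNF formula if it satisfies every clause. -/
def satCNF (θ : Var → Bool) (φ : CNF) : Prop := ∀ C ∈ φ, satClause θ C

/-- Entailment `φ ⊨ ψ` between CNF formulas. -/
def entails (φ ψ : CNF) : Prop := ∀ θ : Var → Bool, satCNF θ φ → satCNF θ ψ

/-- Variables of a clause. -/
def varsClause (C : Clause) : Finset Var := C.image Prod.fst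

/-- Variables of a CNF formula. -/
def varsCNF (φ : CNF) : Finset Var := φ.sup varsClause

/-- A clause is tautological if it contains `x` and `¬x` for some variable `x`. -/
def tautClause (C : Clause) : Prop := ∃ x : Var, (x, true) ∈ C ∧ (x, false) ∈ C

/-- A CNF formula has no tautological clauses. -/
def noTaut (φ : CNF) : Prop := ∀ C ∈ φ, ¬ tautClause C

/-- An extended literal over variable `x` is `x` (`some true`), `¬x` (`some false`),
or `x_ε` (`none`). -/
abbrev ELit := Var × Option Bool

/-- The reduct `φ[e]` of a CNF formula by a single extended literal:
for a literal `ℓ` delete every clause containing `ℓ` and remove `∼ℓ` from the rest;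
for `x_ε` delete all occurrences of the literals `x` and `¬x` from all clauses. -/
def reduct1 (φ : CNF) (e : ELit) : CNF :=
  match e.2 with
  | some b => (φ.filter (fun C => (e.1, b) ∉ C)).image (fun C => C.erase (e.1, !b))
  | none => φ.image (fun C => (C.erase (e.1, true)).erase (e.1, false))

/-- Successive application of reducts along a list of extended literals. -/
def reductL (φ : CNF) (Y : List ELit) : CNF := Y.foldl reduct1 φ

/-- `Y` represents an element of `tA(X)`: it chooses, for each variable of `X`, exactly
one of `x`, `¬x`, `x_ε` (the variables of `Y` are pairwise distinct and cover exactly `X`). -/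
def isTAList (X : Finset Var) (Y : List ELit) : Prop :=
  (Y.map Prod.fst).Nodup ∧ (Y.map Prod.fst).toFinset = X

/-- `φ'` is a subformula of `φ`: every clause of `φ'` is contained in some clause of `φ`. -/
def subformula (φ' φ : CNF) : Prop := ∀ C' ∈ φ', ∃ C ∈ φ, C' ⊆ C

/-- A class of CNF formulas is clause-induced if it is closed under subformulas. -/
def clauseInduced (Cl : Set CNF) : Prop :=
  ∀ φ ∈ Cl, ∀ φ' : CNF, subformula φ' φ → φ' ∈ Cl

/-- A monotone CNF formula: only positive literals. -/
def monotoneCNF (φ : CNF) : Prop := ∀ C ∈ φ, ∀ l ∈ C, l.2 = true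

/-- A Horn CNF formula: every clause has at most one positive literal. -/
def hornCNF (φ : CNF) : Prop :=
  ∀ C ∈ φ, ∀ l ∈ C, ∀ l' ∈ C, l.2 = true → l'.2 = true → l = l'

/-- A Krom CNF formula: every clause has at most two literals. -/
def kromCNF (φ : CNF) : Prop := ∀ C ∈ φ, C.card ≤ 2

/-- A default rule `α : β / γ`. -/
structure DRule where
  pre : CNF
  just : CNF
  concl : CNF

/-- A default theory `⟨W, D⟩`: a finite set `W` of CNF formulas and a finite
(ordered, so that the fresh variables `y_i` can be attached) set `D` of default rules. -/
structure DTheory where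
  W : Finset CNF
  D : List DRule

/-- `Φ ⊨ ψ` for a set of CNF formulas. -/
def entailsSet (Φ : Set CNF) (ψ : CNF) : Prop :=
  ∀ θ : Var → Bool, (∀ φ ∈ Φ, satCNF θ φ) → satCNF θ ψ

/-- Deductive closure `Th(Φ)`. -/
def Th (Φ : Set CNF) : Set CNF := {ψ | entailsSet Φ ψ}

/-- The justification `β` is not violated by `E`, i.e. `¬β ∉ E` (semantically: `E ⊭ ¬β`,
some assignment satisfies `E` together with `β`). -/
def notViolated (E : Set CNF) (β : CNF) : Prop :=
  ∃ θ : Var → Bool, (∀ φ ∈ E, satCNF θ φ) ∧ satCNF θ β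

/-- `S` satisfies the closure conditions defining `Γ(E)`. -/
def closedFor (T : DTheory) (E S : Set CNF) : Prop :=
  (↑T.W : Set CNF) ⊆ S ∧ Th S = S ∧
    ∀ d ∈ T.D, d.pre ∈ S → notViolated E d.just → d.concl ∈ S

/-- `Γ(E)`: the smallest set `S` with `W ⊆ S`, `Th(S) = S`, closed under applicable defaults. -/
def Gamma (T : DTheory) (E : Set CNF) : Set CNF := ⋂₀ {S : Set CNF | closedFor T E S}

/-- `E` is a stable extension of `⟨W,D⟩` iff `Γ(E) = E`. -/
def stableExt (T : DTheory) (E : Set CNF) : Prop := Gamma T E = E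

/-- A set of formulas is consistent if it is satisfiable. -/
def consistentE (E : Set CNF) : Prop := ∃ θ : Var → Bool, ∀ φ ∈ E, satCNF θ φ

/-- The set of consistent stable extensions of a default theory. -/
def SE (T : DTheory) : Set (Set CNF) := {E | stableExt T E ∧ consistentE E}

/-- Variables of a default rule. -/
def varsRule (d : DRule) : Finset Var := varsCNF d.pre ∪ varsCNF d.just ∪ varsCNF d.concl

/-- Variables of a default theory. -/
def varsTheory (T : DTheory) : Finset Var :=
  T.W.sup varsCNF ∪ T.D.foldr (fun d s => varsRule d ∪ s) ∅

/-- The formulas occurring in a default theory: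
`F = W ∪ {α, β, γ : α:β/γ ∈ D}`. -/
def thForms (T : DTheory) : Set CNF :=
  (↑T.W : Set CNF) ∪ {φ | ∃ d ∈ T.D, φ = d.pre ∨ φ = d.just ∨ φ = d.concl}

/-- Conjoin the fresh positive unit clause `y_i` to a formula. -/
def addY (φ : CNF) (yi : Var) : CNF := φ ∪ {({(yi, true)} : Clause)}

/-- The reduct `⟨W,D⟩[e]` of a default theory by one extended literal, where `y i`
is the fresh variable attached to the `i`-th default rule. -/
def thReduct1 (y : ℕ → Var) (T : DTheory) (e : ELit) : DTheory :=
  ⟨T.W.image (fun ω => reduct1 ω e),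
   T.D.mapIdx (fun i d =>
     ⟨reduct1 d.pre e, reduct1 d.just e, addY (reduct1 d.concl e) (y i)⟩)⟩

/-- Successive application of theory reducts along a list of extended literals. -/
def thReductL (y : ℕ → Var) (T : DTheory) (Y : List ELit) : DTheory :=
  Y.foldl (thReduct1 y) T

/-- `B` is a strong `Cl`-backdoor of `T`: for every `Y ∈ tA(B)`, every formula
occurring in `⟨W,D⟩[Y]` belongs to `Cl`. -/
def strongBackdoor (y : ℕ → Var) (Cl : Set CNF) (T : DTheory) (B : Finset Var) : Prop :=
  ∀ Y : List ELit, isTAList B Y → ∀ φ ∈ thForms (thReductL y T Y), φ ∈ Cl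

/-- The fresh variables `y i` are pairwise distinct and do not occur in `T` nor in `B`. -/
def freshFor (y : ℕ → Var) (T : DTheory) (B : Finset Var) : Prop :=
  Function.Injective y ∧ ∀ i : ℕ, y i ∉ varsTheory T ∪ B

/-- `concl(D,E) = {γ_i : E ⊨ y_i}`. -/
def conclOf (y : ℕ → Var) (D : List DRule) (E : Set CNF) : Set CNF :=
  {γ | ∃ i : Fin D.length, γ = (D.get i).concl ∧
        entailsSet E {({(y i.1, true)} : Clause)}}

theorem noTaut.of_subformula {φ φ' : CNF} (hφ : noTaut φ) (h : subformula φ' φ) : noTaut φ' := by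
  rintro C' hC' ⟨x, hpos, hneg⟩
  obtain ⟨C, hC, hsub⟩ := h C' hC'
  exact hφ C hC ⟨x, hsub hpos, hsub hneg⟩

theorem subformula_reduct1 (φ : CNF) (e : ELit) : subformula (reduct1 φ e) φ := by
  obtain ⟨x, _ | b⟩ := e <;> intro C' hC' <;> simp only [reduct1, Finset.mem_image] at hC'
  · obtain ⟨C, hC, rfl⟩ := hC'
    exact ⟨C, hC, (Finset.erase_subset _ _).trans (Finset.erase_subset _ _)⟩
  · obtain ⟨C, hC, rfl⟩ := hC'
    exact ⟨C, (Finset.mem_filter.mp hC).1, Finset.erase_subset _ _⟩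

/-- A satisfied clause in which the true literal of `x` does not occur is satisfied by a literal
over another variable. -/
theorem exists_ne_of_satClause_update {θ : Var → Bool} {x : Var} {b : Bool} {C : Clause}
    (h : satClause (Function.update θ x b) C) (hb : (x, b) ∉ C) :
    ∃ l ∈ C, l.1 ≠ x ∧ θ l.1 = l.2 := by
  obtain ⟨⟨v, c⟩, hl, hv⟩ := h
  by_cases hvx : v = x
  · subst hvx
    simp only [Function.update_self] at hv
    exact absurd (hv ▸ hl) hb
  · exact ⟨(v, c), hl, hvx, by simpa [hvx] using hv⟩

theorem satClause_update_of_ne {θ : Var → Bool} {x : Var} {C : Clause} (b : Bool) {l : Lit}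
    (hl : l ∈ C) (hx : l.1 ≠ x) (hθ : θ l.1 = l.2) : satClause (Function.update θ x b) C :=
  ⟨l, hl, by rwa [Function.update_of_ne hx]⟩

theorem satCNF_reduct1_some_iff {θ : Var → Bool} {φ : CNF} {x : Var} {b : Bool} :
    satCNF θ (reduct1 φ (x, some b)) ↔ satCNF (Function.update θ x b) φ := by
  simp only [satCNF, reduct1, Finset.forall_mem_image, Finset.mem_filter]
  constructor
  · intro h C hC
    by_cases hb : (x, b) ∈ C
    · exact ⟨(x, b), hb, by simp⟩
    · obtain ⟨⟨v, c⟩, hl, hθ⟩ := h ⟨hC, hb⟩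
      rw [Finset.mem_erase] at hl
      refine satClause_update_of_ne b hl.2 ?_ hθ
      rintro rfl
      cases b <;> cases c <;> simp_all
  · rintro h C ⟨hC, hb⟩
    obtain ⟨l, hl, hx, hθ⟩ := exists_ne_of_satClause_update (h C hC) hb
    exact ⟨l, Finset.mem_erase.mpr ⟨fun e => hx (by rw [e]), hl⟩, hθ⟩

theorem satCNF_update_of_reduct1_none {θ : Var → Bool} {φ : CNF} {x : Var}
    (h : satCNF θ (reduct1 φ (x, none))) (b : Bool) : satCNF (Function.update θ x b) φ := by
  simp only [satCNF, reduct1, Finset.forall_mem_image] at h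
  intro C hC
  obtain ⟨⟨v, c⟩, hl, hθ⟩ := h hC
  simp only [Finset.mem_erase] at hl
  refine satClause_update_of_ne b hl.2.2 ?_ hθ
  rintro rfl
  cases c <;> simp_all

theorem satCNF_reduct1_none {θ : Var → Bool} {φ : CNF} {x : Var} (hφ : noTaut φ)
    (h : ∀ b, satCNF (Function.update θ x b) φ) : satCNF θ (reduct1 φ (x, none)) := by
  simp only [satCNF, reduct1, Finset.forall_mem_image]
  intro C hC
  obtain ⟨b, hb⟩ : ∃ b, (x, b) ∉ C := by
    by_contra! hall
    exact hφ C hC ⟨x, hall true, hall false⟩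
  obtain ⟨l, hl, hx, hθ⟩ := exists_ne_of_satClause_update (h b C hC) hb
  refine ⟨l, ?_, hθ⟩
  simp only [Finset.mem_erase]
  exact ⟨fun e => hx (by rw [e]), fun e => hx (by rw [e]), hl⟩

theorem entails.reduct1 {ψ φ : CNF} (hφ : noTaut φ) (h : entails ψ φ) (e : ELit) :
    entails (reduct1 ψ e) (reduct1 φ e) := by
  obtain ⟨x, _ | b⟩ := e <;> intro θ hθ
  · exact satCNF_reduct1_none hφ fun b => h _ (satCNF_update_of_reduct1_none hθ b)
  · exact satCNF_reduct1_some_iff.mpr (h _ (satCNF_reduct1_some_iff.mp hθ))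

theorem entails.reductL {ψ φ : CNF} (hφ : noTaut φ) (h : entails ψ φ) (Y : List ELit) :
    entails (reductL ψ Y) (reductL φ Y) := by
  induction Y generalizing ψ φ with
  | nil => exact h
  | cons e Y ih => exact ih (hφ.of_subformula (subformula_reduct1 φ e)) (h.reduct1 hφ e)

/-- for formulas without tautological clauses, implication is
invariant under reducts by any `Y ∈ tA(X)`. -/
theorem stmt3 (ψ φ : CNF) (hψ : noTaut ψ) (hφ : noTaut φ)
    (X : Finset Var) (hX : X ⊆ varsCNF ψ ∪ varsCNF φ)
    (h : entails ψ φ) :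
    ∀ Y : List ELit, isTAList X Y →
      entails (reductL ψ Y) (reductL φ Y) :=
  fun Y _ => h.reductL hφ Y
end

section
/- Let C be a clause-induced class of CNF formulas that contains every positive unit clause, let T = ⟨W,D⟩ be a CNF default theory, let v be a variable of T, and let B be a set of variables of T with v ∈ B. Then B is a strong C-backdoor of T if and only if B \ {v} is a strong C-backdoor of each of the three reduct theories T[{v}], T[{¬v}], and T[{v_ε}]. -/
theorem mem_reduct1_some {φ : CNF} {v : Var} {b : Bool} {C : Clause} :
    C ∈ reduct1 φ (v, some b) ↔ ∃ A ∈ φ, (v, b) ∉ A ∧ A.erase (v, !b) = C := by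
  simp [reduct1, and_assoc]

theorem mem_reduct1_none {φ : CNF} {v : Var} {C : Clause} :
    C ∈ reduct1 φ (v, none) ↔ ∃ A ∈ φ, (A.erase (v, true)).erase (v, false) = C := by
  simp [reduct1]

/-- Reducts over distinct variables commute. -/
theorem reduct1_comm (φ : CNF) {e f : ELit} (h : e.1 ≠ f.1) :
    reduct1 (reduct1 φ e) f = reduct1 (reduct1 φ f) e := by
  have key : ∀ {e f : ELit}, e.1 ≠ f.1 →
      reduct1 (reduct1 φ e) f ⊆ reduct1 (reduct1 φ f) e := by
    rintro ⟨v, _ | b⟩ ⟨w, _ | c⟩ h C hC <;>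
    simp only [mem_reduct1_none, mem_reduct1_some] at hC ⊢ <;> simp only at h
    · obtain ⟨_, ⟨A, hA, rfl⟩, rfl⟩ := hC
      exact ⟨_, ⟨A, hA, rfl⟩, by grind⟩
    · obtain ⟨_, ⟨A, hA, rfl⟩, hc, rfl⟩ := hC
      exact ⟨_, ⟨A, hA, by grind, rfl⟩, by grind⟩
    · obtain ⟨_, ⟨A, hA, hb, rfl⟩, rfl⟩ := hC
      exact ⟨_, ⟨A, hA, rfl⟩, by grind, by grind⟩
    · obtain ⟨_, ⟨A, hA, hb, rfl⟩, hc, rfl⟩ := hC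
      exact ⟨_, ⟨A, hA, by grind, rfl⟩, by grind, by grind⟩
  exact (key h).antisymm (key h.symm)

theorem reduct1_addY (φ : CNF) {x : Var} {e : ELit} (h : e.1 ≠ x) :
    reduct1 (addY φ x) e = addY (reduct1 φ e) x := by
  have herase (b : Bool) : ({(x, true)} : Clause).erase (e.1, b) = {(x, true)} :=
    Finset.erase_eq_of_notMem (by simp [h])
  obtain ⟨v, _ | b⟩ := e <;>
    simp_all [reduct1, addY, Finset.filter_insert]

theorem addY_addY (φ : CNF) (x : Var) : addY (addY φ x) x = addY φ x := by
  simp [addY]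

/-- Theory reducts over distinct non-fresh variables commute. -/
theorem thReduct1_comm {y : ℕ → Var} (T : DTheory) {e f : ELit} (h : e.1 ≠ f.1)
    (he : ∀ i, y i ≠ e.1) (hf : ∀ i, y i ≠ f.1) :
    thReduct1 y (thReduct1 y T e) f = thReduct1 y (thReduct1 y T f) e := by
  simp only [thReduct1, Finset.image_image, List.mapIdx_mapIdx, Function.comp_def,
    reduct1_comm _ h, reduct1_addY _ (he _).symm, reduct1_addY _ (hf _).symm, addY_addY]

/-- Reducing a theory by the choices in `Y` does not depend on their order. -/
theorem thReductL_perm {y : ℕ → Var} (T : DTheory) {Y Z : List ELit} (h : Y.Perm Z)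
    (hnd : (Y.map Prod.fst).Nodup) (hy : ∀ e ∈ Y, ∀ i, y i ≠ e.1) :
    thReductL y T Y = thReductL y T Z := by
  refine h.foldl_eq' (fun e he f hf T => ?_) T
  by_cases hef : e.1 = f.1
  · rw [List.inj_on_of_nodup_map hnd he hf hef]
  · exact thReduct1_comm T hef (hy e he) (hy f hf)

theorem isTAList_cons_iff {v : Var} {B : Finset Var} (hv : v ∈ B) (o : Option Bool)
    {Y : List ELit} : isTAList B ((v, o) :: Y) ↔ isTAList (B.erase v) Y := by
  simp only [isTAList, List.map_cons, List.nodup_cons, List.toFinset_cons]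
  constructor
  · rintro ⟨⟨hvY, hY⟩, rfl⟩
    exact ⟨hY, (Finset.erase_insert (by simpa using hvY)).symm⟩
  · rintro ⟨hY, hB⟩
    refine ⟨⟨fun h => ?_, hY⟩, by rw [hB, Finset.insert_erase hv]⟩
    exact Finset.notMem_erase v B (hB ▸ List.mem_toFinset.2 h)

theorem isTAList.perm {B : Finset Var} {Y Z : List ELit} (hY : isTAList B Y) (h : Y.Perm Z) :
    isTAList B Z :=
  ⟨(h.map _).nodup_iff.1 hY.1, (List.toFinset_eq_of_perm _ _ (h.map _)).symm.trans hY.2⟩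

/-- self-reduction. For a clause-induced class `Cl` containing every
positive unit clause, `v ∈ B`: `B` is a strong `Cl`-backdoor of `T` iff `B \ {v}` is a
strong `Cl`-backdoor of each of the three reducts `T[{v}]`, `T[{¬v}]`, `T[{v_ε}]`. -/
theorem stmt11 (Cl : Set CNF) (hCl : clauseInduced Cl)
    (hunit : ∀ x : Var, ({({(x, true)} : Clause)} : CNF) ∈ Cl)
    (T : DTheory) (y : ℕ → Var) (v : Var) (B : Finset Var)
    (hv : v ∈ B) (hB : B ⊆ varsTheory T) (hy : freshFor y T B) :
    strongBackdoor y Cl T B ↔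
      (strongBackdoor y Cl (thReductL y T [(v, some true)]) (B.erase v) ∧
       strongBackdoor y Cl (thReductL y T [(v, some false)]) (B.erase v) ∧
       strongBackdoor y Cl (thReductL y T [(v, none)]) (B.erase v)) := by
  have hfwd (h : strongBackdoor y Cl T B) (o : Option Bool) :
      strongBackdoor y Cl (thReductL y T [(v, o)]) (B.erase v) :=
    fun Y hY => h ((v, o) :: Y) ((isTAList_cons_iff hv o).2 hY)
  refine ⟨fun h => ⟨hfwd h _, hfwd h _, hfwd h _⟩, fun ⟨htrue, hfalse, hnone⟩ Y hY => ?_⟩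
  have hback (o : Option Bool) :
      strongBackdoor y Cl (thReductL y T [(v, o)]) (B.erase v) := by
    rcases o with _ | _ | _ <;> assumption
  have hmem {e : ELit} (he : e ∈ Y) : e.1 ∈ B :=
    hY.2 ▸ List.mem_toFinset.2 (List.mem_map_of_mem he)
  obtain ⟨⟨w, o⟩, he, rfl⟩ : ∃ e ∈ Y, e.1 = v := by
    rw [← hY.2] at hv
    simpa using hv
  have hp : Y.Perm ((w, o) :: Y.erase (w, o)) := List.perm_cons_erase he
  have hfresh : ∀ e ∈ Y, ∀ i, y i ≠ e.1 := fun e he i hi =>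
    hy.2 i (Finset.mem_union_right _ (by rw [hi]; exact hmem he))
  rw [thReductL_perm T hp hY.1 hfresh]
  exact hback o _ ((isTAList_cons_iff hv o).1 (hY.perm hp))
end
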